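/- arXiv:1205.4344 — 2 statements merged into one kernel-verified Lean document; each statement's English description precedes it below -/
import Mathlib

section
/- Let C ⊂ ℝ^m be a convex cone and let A_{i,j} = (Δ_{i,j}, Φ_{i,j}) for i = 1,…,n, j = 1,…,p be bounded pairs of polyhedra in ℝ^m parallel to C. Then I( (A_{1,1} * … * A_{n,1}) + … + (A_{1,p} * … * A_{n,p}) ) = Σ_{a_1 + … + a_n = p, a_i ≥ 0} I( ⋁_{J_1 ⊔ … ⊔ J_n = {1,…,p}, |J_1| = a_1, …, |J_n| = a_n} Σ_{i = 1,…,n, j ∈ J_i} Δ_{i,j} , ⋁_{J_1 ⊔ … ⊔ J_n = {1,…,p}, |J_1| = a_1, …, |J_n| = a_n} Σ_{i = 1,…,n, j ∈ J_i} Φ_{i,j} ), where the outer sum on the right is over all n-tuples of nonnegative integers summing to p. -/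
/-!
STATEMENT 7 (lattice point count for sums of Cayley pairs).
For bounded pairs of (lattice) polyhedra `A_{i,j} = (Δ_{i,j}, Φ_{i,j})` in `ℝ^m`
parallel to a convex cone `C` (`i = 1,…,n`, `j = 1,…,p`):
`I((A_{1,1}*…*A_{n,1}) + … + (A_{1,p}*…*A_{n,p}))
 = Σ_{a_1+…+a_n=p} I(⋁ Σ Δ_{i,j}, ⋁ Σ Φ_{i,j})`,
the join being over all decompositions of `{1,…,p}` into disjoint sets `J_i` with
`|J_i| = a_i`.  Here `I(Δ,Φ) = #(ℤ-points of Δ\Φ) − #(ℤ-points of Φ\Δ)`.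
-/

open Set Bornology

noncomputable section

/-- A polyhedron: an intersection of finitely many closed half-spaces. -/
def IsPolyhedron {m : ℕ} (A : Set (Fin m → ℝ)) : Prop :=
  ∃ (N : ℕ) (γ : Fin N → ((Fin m → ℝ) →ₗ[ℝ] ℝ)) (c : Fin N → ℝ),
    A = ⋂ t, {x | c t ≤ γ t x}

/-- Two subsets of `ℝ^m` are parallel: they admit exactly the same translations into
themselves. -/
def Parallel {m : ℕ} (A B : Set (Fin m → ℝ)) : Prop :=
  ∀ a : Fin m → ℝ, ((fun x => a + x) '' A ⊆ A ↔ (fun x => a + x) '' B ⊆ B)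

/-- A convex cone in `ℝ^m`. -/
def IsConvexCone {m : ℕ} (C : Set (Fin m → ℝ)) : Prop :=
  Convex ℝ C ∧ ∀ x ∈ C, ∀ t : ℝ, 0 < t → t • x ∈ C

/-- Minkowski sum of the sets `Δ j`, `j ∈ J`. -/
def minkSum {ι E : Type*} [AddCommMonoid E] (J : Finset ι) (Δ : ι → Set E) : Set E :=
  {y | ∃ x : ι → E, (∀ j ∈ J, x j ∈ Δ j) ∧ y = ∑ j ∈ J, x j}

/-- The Cayley points `b_1,…,b_n ∈ ℝ^{n−1}`: the standard basis vectors and `b_n = 0`. -/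
def cayleyPt (n : ℕ) (i : Fin n) : Fin (n - 1) → ℝ :=
  fun l => if (i : ℕ) = (l : ℕ) then 1 else 0

/-- The Cayley polyhedron `Δ_1 * … * Δ_n ⊂ ℝ^{n−1} ⊕ ℝ^m`. -/
def cayley (n m : ℕ) (Δ : Fin n → Set (Fin m → ℝ)) :
    Set ((Fin (n - 1) → ℝ) × (Fin m → ℝ)) :=
  convexHull ℝ (⋃ i, {cayleyPt n i} ×ˢ Δ i)

/-- `I(Δ,Φ)` in `ℝ^{n−1} ⊕ ℝ^m`: the number of integer points in `Δ \ Φ` minus the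
number of integer points in `Φ \ Δ`. -/
def IpairProd {a b : ℕ} (Δ Φ : Set ((Fin a → ℝ) × (Fin b → ℝ))) : ℤ :=
  (Set.ncard {z : (Fin a → ℤ) × (Fin b → ℤ) |
      ((fun l => (z.1 l : ℝ)), (fun l => (z.2 l : ℝ))) ∈ Δ \ Φ} : ℤ) -
  (Set.ncard {z : (Fin a → ℤ) × (Fin b → ℤ) |
      ((fun l => (z.1 l : ℝ)), (fun l => (z.2 l : ℝ))) ∈ Φ \ Δ} : ℤ)

/-- `I(Δ,Φ)` in `ℝ^m`. -/
def Ipair {m : ℕ} (Δ Φ : Set (Fin m → ℝ)) : ℤ :=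
  (Set.ncard {z : Fin m → ℤ | (fun l => (z l : ℝ)) ∈ Δ \ Φ} : ℤ) -
  (Set.ncard {z : Fin m → ℤ | (fun l => (z l : ℝ)) ∈ Φ \ Δ} : ℤ)

/-- The join `⋁_{J_1⊔…⊔J_n={1,…,p}, |J_i|=a_i} Σ_{i, j∈J_i} Δ_{i,j}`. -/
def joinOfPartitions {m n p : ℕ} (Δ : Fin n → Fin p → Set (Fin m → ℝ))
    (a : Fin n → ℕ) : Set (Fin m → ℝ) :=
  convexHull ℝ (⋃ f ∈ {f : Fin p → Fin n |
      ∀ i, (Finset.univ.filter (fun j => f j = i)).card = a i},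
    minkSum Finset.univ (fun j => Δ (f j) j))

/-- `A` is convex, stable under translations by `K`, and `A ⊆ P + K` for some bounded `P ⊆ A`. -/
structure IsConeGenerated {E : Type*} [NormedAddCommGroup E] [NormedSpace ℝ E]
    (K : ConvexCone ℝ E) (A : Set E) : Prop where
  convex : Convex ℝ A
  add_mem : ∀ x ∈ A, ∀ k ∈ K, x + k ∈ A
  exists_bounded : ∃ P ⊆ A, IsBounded P ∧ ∀ x ∈ A, ∃ y ∈ P, ∃ k ∈ K, x = y + k

theorem exists_mem_of_isBounded_diff {E : Type*} [NormedAddCommGroup E] {A B : Set E}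
    (h : IsBounded (A \ B)) : ∃ r : ℝ, ∀ x ∈ A, r < ‖x‖ → x ∈ B := by
  obtain ⟨r, h⟩ := h.exists_norm_le
  refine ⟨r, fun x hx hxr => ?_⟩
  by_contra hxB
  exact absurd (h x ⟨hx, hxB⟩) (not_le.2 hxr)

theorem isBounded_diff_trans {E : Type*} [NormedAddCommGroup E] {A B C : Set E} (h : IsBounded (A \ B)) (h' : IsBounded (B \ C)) :
    IsBounded (A \ C) := by
  refine (h.union h').subset fun x hx => ?_
  by_cases hB : x ∈ B
  · exact Or.inr ⟨hB, hx.2⟩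
  · exact Or.inl ⟨hx.1, hB⟩

section ConeGenerated

variable {E : Type*} [NormedAddCommGroup E] [NormedSpace ℝ E] {K : ConvexCone ℝ E}

theorem isConeGenerated_empty : IsConeGenerated K (∅ : Set E) :=
  ⟨convex_empty, by simp, ∅, by simp⟩

theorem IsConeGenerated.add {A B : Set E} (hA : IsConeGenerated K A)
    (hB : IsConeGenerated K B) : IsConeGenerated K (Set.image2 (· + ·) A B) := by
  obtain ⟨P, hPA, hP, hAP⟩ := hA.exists_bounded
  obtain ⟨Q, hQB, hQ, hBQ⟩ := hB.exists_bounded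
  refine ⟨hA.convex.add hB.convex, ?_, Set.image2 (· + ·) P Q, image2_subset hPA hQB,
    Bornology.IsBounded.add hP hQ, ?_⟩
  · rintro _ ⟨a, ha, b, hb, rfl⟩ k hk
    exact ⟨a, ha, b + k, hB.add_mem b hb k hk, by simp [add_assoc]⟩
  · rintro _ ⟨a, ha, b, hb, rfl⟩
    obtain ⟨y, hy, k, hk, rfl⟩ := hAP a ha
    obtain ⟨z, hz, l, hl, rfl⟩ := hBQ b hb
    exact ⟨y + z, ⟨y, hy, z, hz, rfl⟩, k + l, K.add_mem hk hl, add_add_add_comm _ _ _ _⟩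

theorem IsConeGenerated.convexHull_union {A B : Set E} (hA : IsConeGenerated K A)
    (hB : IsConeGenerated K B) : IsConeGenerated K (convexHull ℝ (A ∪ B)) := by
  obtain ⟨P, hPA, hP, hAP⟩ := hA.exists_bounded
  obtain ⟨Q, hQB, hQ, hBQ⟩ := hB.exists_bounded
  refine ⟨convex_convexHull ℝ _, ?_, convexHull ℝ (P ∪ Q),
    convexHull_mono (union_subset_union hPA hQB), isBounded_convexHull.2 (hP.union hQ), ?_⟩
  · intro x hx k hk
    have hconv : Convex ℝ {x | x + k ∈ convexHull ℝ (A ∪ B)} :=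
      (convex_convexHull ℝ (A ∪ B)).translate_preimage_left k
    refine convexHull_min ?_ hconv hx
    rintro y (hy | hy)
    · exact subset_convexHull ℝ _ (Or.inl (hA.add_mem y hy k hk))
    · exact subset_convexHull ℝ _ (Or.inr (hB.add_mem y hy k hk))
  · have hconv : Convex ℝ (Set.image2 (· + ·) (convexHull ℝ (P ∪ Q)) (K : Set E)) :=
      (convex_convexHull ℝ _).add K.convex
    intro x hx
    have hsub : A ∪ B ⊆ Set.image2 (· + ·) (convexHull ℝ (P ∪ Q)) (K : Set E) := by
      rintro y (hy | hy)
      · obtain ⟨z, hz, k, hk, rfl⟩ := hAP y hy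
        exact ⟨z, subset_convexHull ℝ _ (Or.inl hz), k, hk, rfl⟩
      · obtain ⟨z, hz, k, hk, rfl⟩ := hBQ y hy
        exact ⟨z, subset_convexHull ℝ _ (Or.inr hz), k, hk, rfl⟩
    obtain ⟨y, hy, k, hk, h⟩ := convexHull_min hsub hconv hx
    exact ⟨y, hy, k, hk, h.symm⟩

theorem isBounded_add_diff_add {A A' B : Set E} (hA : IsConeGenerated K A)
    (hB : IsConeGenerated K B) (h : IsBounded (A \ A')) :
    IsBounded (Set.image2 (· + ·) A B \ Set.image2 (· + ·) A' B) := by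
  obtain ⟨P, hPB, hP, hBP⟩ := hB.exists_bounded
  obtain ⟨r, hr⟩ := exists_mem_of_isBounded_diff h
  obtain ⟨s, hs⟩ := hP.exists_norm_le
  refine isBounded_iff_forall_norm_le.2 ⟨r + s, ?_⟩
  rintro _ ⟨⟨a, ha, b, hb, rfl⟩, hx⟩
  by_contra! hlt
  obtain ⟨y, hy, k, hk, rfl⟩ := hBP b hb
  refine hx ⟨a + k, hr _ (hA.add_mem a ha k hk) ?_, y, hPB hy, by simp only; abel⟩
  have h1 : ‖a + (y + k)‖ ≤ ‖a + k‖ + ‖y‖ := by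
    rw [show a + (y + k) = (a + k) + y by abel]; exact norm_add_le _ _
  have := hs y hy
  linarith

theorem isBounded_convexHull_union_diff {A A' B : Set E} (hA : IsConeGenerated K A)
    (hB : IsConeGenerated K B) (h : IsBounded (A \ A')) :
    IsBounded (convexHull ℝ (A ∪ B) \ convexHull ℝ (A' ∪ B)) := by
  rcases A.eq_empty_or_nonempty with rfl | hA0
  · rw [sdiff_eq_empty.2 (convexHull_mono (by simp))]
    exact isBounded_empty
  rcases B.eq_empty_or_nonempty with rfl | hB0
  · refine h.subset ?_
    rw [union_empty, union_empty, hA.convex.convexHull_eq]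
    exact sdiff_subset_sdiff_right (subset_convexHull ℝ _)
  obtain ⟨P, hPB, hP, hBP⟩ := hB.exists_bounded
  obtain ⟨r, hr⟩ := exists_mem_of_isBounded_diff h
  obtain ⟨s, hs⟩ := hP.exists_norm_le
  refine isBounded_iff_forall_norm_le.2 ⟨r + s, ?_⟩
  rintro x ⟨hx, hx'⟩
  rw [hA.convex.convexHull_union hB.convex hA0 hB0, mem_convexJoin] at hx
  obtain ⟨a, ha, b, hb, u, v, hu, hv, huv, rfl⟩ := hx
  by_contra! hlt
  obtain ⟨y, hy, k, hk, rfl⟩ := hBP b hb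
  apply hx'
  have hsub : ∀ z ∈ A', ∀ w ∈ B, u • z + v • w ∈ convexHull ℝ (A' ∪ B) := fun z hz w hw =>
    (convex_convexHull ℝ (A' ∪ B)) (subset_convexHull ℝ _ (Or.inl hz))
      (subset_convexHull ℝ _ (Or.inr hw)) hu hv huv
  rcases hu.eq_or_lt with rfl | hu
  · obtain rfl : v = 1 := by linarith
    rw [zero_smul, one_smul, zero_add]
    exact subset_convexHull ℝ _ (Or.inr hb)
  rcases hv.eq_or_lt with rfl | hv
  · obtain rfl : u = 1 := by linarith
    rw [zero_smul, one_smul, add_zero] at hlt ⊢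
    exact subset_convexHull ℝ _ (Or.inl (hr a ha (by linarith [(norm_nonneg y).trans (hs y hy)])))
  have hx : u • a + v • (y + k) = u • (a + (v / u) • k) + v • y := by
    rw [smul_add, smul_add, smul_smul, mul_div_cancel₀ _ hu.ne']; abel
  rw [hx] at hlt ⊢
  refine hsub _ (hr _ (hA.add_mem a ha _ (K.smul_mem (div_pos hv hu) hk)) ?_) y (hPB hy)
  set z := a + (v / u) • k
  have h1 : ‖u • z + v • y‖ ≤ u * ‖z‖ + v * ‖y‖ := by
    refine (norm_add_le _ _).trans_eq ?_
    rw [norm_smul, norm_smul, Real.norm_of_nonneg hu.le, Real.norm_of_nonneg hv.le]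
  have h2 := hs y hy
  have h3 := norm_nonneg z
  nlinarith [norm_nonneg y]

/-- The relation between cone generated sets that the first one exceeds the second only by a
bounded set. -/
structure ExceedsBoundedly (K : ConvexCone ℝ E) (A B : Set E) : Prop where
  left : IsConeGenerated K A
  right : IsConeGenerated K B
  bounded : IsBounded (A \ B)

theorem ExceedsBoundedly.add {A A' B B' : Set E} (h : ExceedsBoundedly K A A')
    (h' : ExceedsBoundedly K B B') :
    ExceedsBoundedly K (Set.image2 (· + ·) A B) (Set.image2 (· + ·) A' B') := by
  refine ⟨h.left.add h'.left, h.right.add h'.right,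
    isBounded_diff_trans (isBounded_add_diff_add h.left h'.left h.bounded) ?_⟩
  rw [image2_comm (s := A') (t := B) (fun a b => add_comm a b),
    image2_comm (s := A') (t := B') (fun a b => add_comm a b)]
  exact isBounded_add_diff_add h'.left h.right h'.bounded

theorem ExceedsBoundedly.convexHull_union {A A' B B' : Set E} (h : ExceedsBoundedly K A A')
    (h' : ExceedsBoundedly K B B') :
    ExceedsBoundedly K (convexHull ℝ (A ∪ B)) (convexHull ℝ (A' ∪ B')) := by
  refine ⟨h.left.convexHull_union h'.left, h.right.convexHull_union h'.right,
    isBounded_diff_trans (isBounded_convexHull_union_diff h.left h'.left h.bounded) ?_⟩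
  rw [union_comm A' B, union_comm A' B']
  exact isBounded_convexHull_union_diff h'.left h.right h'.bounded

theorem exceedsBoundedly_convexHull_biUnion {ι : Type*} (S : Finset ι) {A B : ι → Set E}
    (h : ∀ i ∈ S, ExceedsBoundedly K (A i) (B i)) :
    ExceedsBoundedly K (convexHull ℝ (⋃ i ∈ S, A i)) (convexHull ℝ (⋃ i ∈ S, B i)) := by
  classical
  induction S using Finset.induction_on with
  | empty => simpa using ⟨isConeGenerated_empty, isConeGenerated_empty, by simp⟩
  | insert i S _ ih =>
    have := (h i (by simp)).convexHull_union (ih fun j hj => h j (by simp [hj]))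
    simpa only [Finset.set_biUnion_insert, convexHull_convexHull_union_right] using this

theorem minkSum_empty {ι F : Type*} [AddCommMonoid F] (A : ι → Set F) :
    minkSum ∅ A = {0} := by
  ext y
  simp [minkSum]

theorem minkSum_insert {ι F : Type*} [DecidableEq ι] [AddCommMonoid F] {i : ι} {J : Finset ι}
    (hi : i ∉ J) (A : ι → Set F) :
    minkSum (insert i J) A = Set.image2 (· + ·) (A i) (minkSum J A) := by
  ext y
  constructor
  · rintro ⟨x, hx, rfl⟩
    exact ⟨x i, hx i (by simp), _, ⟨x, fun j hj => hx j (by simp [hj]), rfl⟩,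
      (Finset.sum_insert hi).symm⟩
  · rintro ⟨a, ha, _, ⟨x, hx, rfl⟩, rfl⟩
    refine ⟨Function.update x i a, fun j hj => ?_, ?_⟩
    · rcases eq_or_ne j i with rfl | hji
      · simpa using ha
      · simpa [hji] using hx j (Finset.mem_of_mem_insert_of_ne hj hji)
    · rw [Finset.sum_insert hi, Function.update_self]
      exact congrArg (a + ·) (Finset.sum_congr rfl fun j hj => by
        rw [Function.update_of_ne (ne_of_mem_of_not_mem hj hi)])

theorem exceedsBoundedly_minkSum {ι : Type*} {J : Finset ι} (hJ : J.Nonempty) {A B : ι → Set E}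
    (h : ∀ i ∈ J, ExceedsBoundedly K (A i) (B i)) :
    ExceedsBoundedly K (minkSum J A) (minkSum J B) := by
  classical
  induction hJ using Finset.Nonempty.cons_induction with
  | singleton i =>
    have : ∀ A : ι → Set E, minkSum {i} A = A i := fun A => by
      simpa [minkSum_empty] using minkSum_insert (Finset.notMem_empty i) A
    simpa only [this] using h i (by simp)
  | cons i J hi _ ih =>
    rw [Finset.cons_eq_insert, minkSum_insert hi, minkSum_insert hi]
    exact (h i (by simp)).add (ih fun j hj => h j (by simp [hj]))

end ConeGenerated

/-- The cone of translations that map a convex cone into itself. -/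
def translationCone {m : ℕ} (C : Set (Fin m → ℝ)) (hC : IsConvexCone C) :
    ConvexCone ℝ (Fin m → ℝ) where
  carrier := {a | ∀ x ∈ C, a + x ∈ C}
  smul_mem' t ht a ha x hx := by
    have := hC.2 _ (ha _ (hC.2 x hx t⁻¹ (inv_pos.2 ht))) t ht
    rwa [smul_add, smul_smul, mul_inv_cancel₀ ht.ne', one_smul] at this
  add_mem' a ha b hb x hx := by
    rw [add_assoc]
    exact ha _ (hb x hx)

theorem Parallel.mem_translationCone_iff {m : ℕ} {A C : Set (Fin m → ℝ)} (hC : IsConvexCone C)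
    (h : Parallel A C) (a : Fin m → ℝ) :
    a ∈ translationCone C hC ↔ ∀ x ∈ A, a + x ∈ A := by
  have := h a
  rw [image_subset_iff, image_subset_iff] at this
  exact this.symm

theorem IsPolyhedron.convex {m : ℕ} {A : Set (Fin m → ℝ)} (hA : IsPolyhedron A) :
    Convex ℝ A := by
  obtain ⟨N, γ, c, rfl⟩ := hA
  exact convex_iInter fun t => convex_halfSpace_ge (γ t).isLinear (c t)

open Filter Topology in
/-- Moving a point `x n` of a polyhedron halfway to the origin along a limit direction `d` of the
sequence stays in the polyhedron eventually. -/
theorem eventually_le_sub_half {m : ℕ} (γ : (Fin m → ℝ) →ₗ[ℝ] ℝ) (c : ℝ)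
    {x : ℕ → Fin m → ℝ} (hx : ∀ n, c ≤ γ (x n)) (hlim : Tendsto (fun n => ‖x n‖) atTop atTop)
    {d : Fin m → ℝ} (hd : Tendsto (fun n => ‖x n‖⁻¹ • x n) atTop (𝓝 d)) :
    0 ≤ γ d ∧ ∀ᶠ n in atTop, c ≤ γ (x n - (‖x n‖ / 2) • d) := by
  have hγ : Tendsto (fun n => ‖x n‖⁻¹ * γ (x n)) atTop (𝓝 (γ d)) := by
    have := ((LinearMap.continuous_of_finiteDimensional γ).tendsto d).comp hd
    simpa [Function.comp_def] using this
  have h0 : 0 ≤ γ d := by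
    have h1 : Tendsto (fun n => ‖x n‖⁻¹ * c) atTop (𝓝 (0 * c)) :=
      hlim.inv_tendsto_atTop.mul_const c
    rw [zero_mul] at h1
    exact le_of_tendsto_of_tendsto' h1 hγ fun n =>
      mul_le_mul_of_nonneg_left (hx n) (by positivity)
  refine ⟨h0, ?_⟩
  rcases h0.eq_or_lt with h0 | h0
  · refine Eventually.of_forall fun n => ?_
    rw [map_sub, map_smul, ← h0, smul_zero, sub_zero]
    exact hx n
  · have h2 : ∀ᶠ n in atTop, 3 / 4 * γ d < ‖x n‖⁻¹ * γ (x n) :=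
      hγ.eventually (lt_mem_nhds (by linarith))
    have h3 := hlim.eventually_ge_atTop (c / (γ d / 4))
    have h4 := hlim.eventually_gt_atTop 0
    filter_upwards [h2, h3, h4] with n h2 h3 h4
    rw [map_sub, map_smul, smul_eq_mul]
    rw [div_le_iff₀ (by linarith)] at h3
    rw [inv_mul_eq_div, lt_div_iff₀ h4] at h2
    linarith

open Filter Topology in
theorem IsPolyhedron.isConeGenerated {m : ℕ} {A C : Set (Fin m → ℝ)} (hC : IsConvexCone C)
    (hA : IsPolyhedron A) (hpar : Parallel A C) :
    IsConeGenerated (translationCone C hC) A := by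
  refine ⟨hA.convex, fun x hx k hk => ?_, ?_⟩
  · rw [add_comm]
    exact (hpar.mem_translationCone_iff hC k).1 hk x hx
  obtain ⟨N, γ, c, rfl⟩ := hA
  set A : Set (Fin m → ℝ) := ⋂ t, {x | c t ≤ γ t x} with hAdef
  have hmem : ∀ x, x ∈ A ↔ ∀ t, c t ≤ γ t x := fun x => by simp [hAdef]
  have hcont : ∀ t, Continuous (γ t) := fun t => LinearMap.continuous_of_finiteDimensional (γ t)
  have hcone : ∀ k, (∀ t, 0 ≤ γ t k) → k ∈ translationCone C hC := fun k hk => by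
    refine (hpar.mem_translationCone_iff hC k).2 fun x hx => (hmem _).2 fun t => ?_
    have := (hmem x).1 hx t
    have := hk t
    rw [map_add]
    linarith
  -- the points of `A` that are closest to the origin among those from which `x` is reachable
  set P : Set (Fin m → ℝ) :=
    {y | y ∈ A ∧ ∀ z ∈ A, (∀ t, γ t z ≤ γ t y) → ‖y‖ ≤ ‖z‖} with hP
  refine ⟨P, fun y hy => hy.1, ?_, fun x hx => ?_⟩
  · by_contra hunb
    have hex : ∀ n : ℕ, ∃ y ∈ P, (n : ℝ) < ‖y‖ := fun n => by
      by_contra! h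
      exact hunb (isBounded_iff_forall_norm_le.2 ⟨n, h⟩)
    choose y hyP hyn using hex
    have hlim : Tendsto (fun n => ‖y n‖) atTop atTop :=
      tendsto_atTop_mono (fun n => (hyn n).le) tendsto_natCast_atTop_atTop
    have hpos : ∀ n, 0 < ‖y n‖ := fun n => (Nat.cast_nonneg n).trans_lt (hyn n)
    obtain ⟨d, -, φ, hφ, hd⟩ := tendsto_subseq_of_bounded
      (Metric.isBounded_closedBall (x := (0 : Fin m → ℝ)) (r := 1))
      (x := fun n => ‖y n‖⁻¹ • y n) (fun n => by
        simp [norm_smul, inv_mul_cancel₀ (hpos n).ne'])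
    have key := fun t => eventually_le_sub_half (γ t) (c t) (x := y ∘ φ)
      (fun n => (hmem _).1 (hyP (φ n)).1 t) (hlim.comp hφ.tendsto_atTop) hd
    have hclose : ∀ᶠ n in atTop, ‖‖y (φ n)‖⁻¹ • y (φ n) - d‖ < 1 / 2 := by
      have := (hd.sub_const d).norm
      rw [sub_self, norm_zero] at this
      exact this.eventually (gt_mem_nhds (by norm_num))
    obtain ⟨n, hn, hnd⟩ := ((eventually_all.2 fun t => (key t).2).and hclose).exists
    set v := y (φ n) with hv
    have hv0 : 0 < ‖v‖ := hpos _
    have hle : ‖v‖ ≤ ‖v - (‖v‖ / 2) • d‖ := by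
      refine (hyP (φ n)).2 _ ((hmem _).2 hn) fun t => ?_
      rw [map_sub, map_smul, smul_eq_mul]
      have := mul_nonneg (half_pos hv0).le (key t).1
      linarith
    have hsplit : v - (‖v‖ / 2) • d = (1 / 2 : ℝ) • v + (‖v‖ / 2) • (‖v‖⁻¹ • v - d) := by
      rw [smul_sub, smul_smul, div_mul_eq_mul_div, mul_inv_cancel₀ hv0.ne', ← add_sub_assoc,
        ← add_smul]
      norm_num
    have h1 : ‖v - (‖v‖ / 2) • d‖ ≤ 1 / 2 * ‖v‖ + ‖v‖ / 2 * ‖‖v‖⁻¹ • v - d‖ := by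
      rw [hsplit]
      refine (norm_add_le _ _).trans_eq ?_
      rw [norm_smul, norm_smul, Real.norm_of_nonneg (half_pos hv0).le]
      norm_num
    nlinarith
  · have hclosed : IsClosed {z | z ∈ A ∧ ∀ t, γ t z ≤ γ t x} := by
      have : {z | z ∈ A ∧ ∀ t, γ t z ≤ γ t x} =
          ⋂ t, ({z | c t ≤ γ t z} ∩ {z | γ t z ≤ γ t x}) := by
        ext z
        simp [hmem, forall_and]
      rw [this]
      exact isClosed_iInter fun t => (isClosed_le continuous_const (hcont t)).inter
        (isClosed_le (hcont t) continuous_const)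
    obtain ⟨y, ⟨hyA, hyx⟩, hy⟩ := hclosed.exists_infDist_eq_dist ⟨x, hx, fun t => le_rfl⟩ 0
    refine ⟨y, ⟨hyA, fun z hz hzy => ?_⟩, x - y, hcone _ fun t => ?_, by abel⟩
    · have := Metric.infDist_le_dist_of_mem (x := (0 : Fin m → ℝ))
        (show z ∈ {z | z ∈ A ∧ ∀ t, γ t z ≤ γ t x} from ⟨hz, fun t => (hzy t).trans (hyx t)⟩)
      rwa [hy, dist_zero_left, dist_zero_left] at this
    · rw [map_sub]
      linarith [hyx t]

theorem isBounded_joinOfPartitions_diff {m n p : ℕ} {C : Set (Fin m → ℝ)} (hC : IsConvexCone C)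
    {Δ Φ : Fin n → Fin p → Set (Fin m → ℝ)}
    (hΔpoly : ∀ i j, IsPolyhedron (Δ i j)) (hΦpoly : ∀ i j, IsPolyhedron (Φ i j))
    (hΔpar : ∀ i j, Parallel (Δ i j) C) (hΦpar : ∀ i j, Parallel (Φ i j) C)
    (hbdd : ∀ i j, IsBounded (Δ i j \ Φ i j)) (a : Fin n → ℕ) :
    IsBounded (joinOfPartitions Δ a \ joinOfPartitions Φ a) := by
  classical
  rcases p.eq_zero_or_pos with rfl | hp
  · obtain rfl : Δ = Φ := Subsingleton.elim _ _
    simp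
  have : Nonempty (Fin p) := ⟨⟨0, hp⟩⟩
  have := exceedsBoundedly_convexHull_biUnion (K := translationCone C hC)
    (Finset.univ.filter fun f : Fin p → Fin n =>
      ∀ i, (Finset.univ.filter (fun j => f j = i)).card = a i)
    (A := fun f => minkSum Finset.univ fun j => Δ (f j) j)
    (B := fun f => minkSum Finset.univ fun j => Φ (f j) j)
    fun f _ => exceedsBoundedly_minkSum Finset.univ_nonempty fun j _ =>
      ⟨(hΔpoly _ _).isConeGenerated hC (hΔpar _ _), (hΦpoly _ _).isConeGenerated hC (hΦpar _ _),
        hbdd _ _⟩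
  simpa [joinOfPartitions] using this.bounded

theorem exists_weights_of_mem_cayley {n m : ℕ} {Δ : Fin n → Set (Fin m → ℝ)}
    (hΔ : ∀ i, Convex ℝ (Δ i)) {z : (Fin (n - 1) → ℝ) × (Fin m → ℝ)} (hz : z ∈ cayley n m Δ) :
    ∃ (w : Fin n → ℝ) (y : Fin n → Fin m → ℝ), (∀ i, 0 ≤ w i) ∧ ∑ i, w i = 1 ∧
      (∀ i, 0 < w i → y i ∈ Δ i) ∧ z = ∑ i, w i • (cayleyPt n i, y i) := by
  rw [cayley, convexHull_eq] at hz
  obtain ⟨ι, T, v, q, hv0, hv1, hq, rfl⟩ := hz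
  have hq' : ∀ t : T, ∃ i, (q t).1 = cayleyPt n i ∧ (q t).2 ∈ Δ i := fun t => by
    simpa using hq t t.2
  choose c hc1 hc2 using hq'
  have hv0' : ∀ t : T, 0 ≤ v t := fun t => hv0 t t.2
  have hz : T.centerMass v q = ∑ t : T, v t • q t := by
    rw [Finset.centerMass_eq_of_sum_1 _ _ hv1, ← Finset.sum_coe_sort T]
  have hv1' : ∑ t : T, v t = 1 := by rw [← hv1, ← Finset.sum_coe_sort T]
  set w : Fin n → ℝ := fun i => ∑ t : T with c t = i, v t with hw
  have hw0 : ∀ i, 0 ≤ w i := fun i => Finset.sum_nonneg fun t _ => hv0' t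
  refine ⟨w, fun i => (Finset.univ.filter (c · = i)).centerMass (fun t => v t) fun t => (q t).2,
    hw0, ?_, fun i hi => ?_, ?_⟩
  · rw [← hv1', hw]
    exact Finset.sum_fiberwise _ c _
  · exact (hΔ i).centerMass_mem (fun t _ => hv0' t) hi fun t ht => by
      rw [← (Finset.mem_filter.1 ht).2]
      exact hc2 t
  · rw [hz, ← Finset.sum_fiberwise _ c]
    refine Finset.sum_congr rfl fun i _ => ?_
    have h1 : ∀ t ∈ Finset.univ.filter (c · = i), v t • q t = v t • (cayleyPt n i, (q t).2) :=
      fun t ht => by rw [← (Finset.mem_filter.1 ht).2, ← hc1 t]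
    rw [Finset.sum_congr rfl h1]
    ext l
    · simp only [Prod.fst_sum, Prod.smul_fst, Finset.sum_apply, Pi.smul_apply, smul_eq_mul, hw]
      rw [Finset.sum_mul]
    · simp only [Prod.snd_sum, Prod.smul_snd]
      rcases (hw0 i).eq_or_lt with h0 | h0
      · rw [← h0, zero_smul, Finset.sum_eq_zero fun t ht => ?_]
        rw [(Finset.sum_eq_zero_iff_of_nonneg fun t _ => hv0' t).1 h0.symm t ht, zero_smul]
      · rw [Finset.centerMass, smul_smul, mul_inv_cancel₀ h0.ne', one_smul]

/-- A nonnegative matrix with column sums one and integer row sums is a convex combination of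
zero-one matrices with the same row and column sums. -/
theorem exists_convexCombination_of_integral_margins {n p : ℕ} {w : Fin n → Fin p → ℝ}
    (h0 : ∀ i j, 0 ≤ w i j) (hcol : ∀ j, ∑ i, w i j = 1) (a : Fin n → ℕ)
    (hrow : ∀ i, ∑ j, w i j = a i) :
    ∃ (v : Equiv.Perm (Fin p) → ℝ) (F : Equiv.Perm (Fin p) → Fin p → Fin n),
      (∀ σ, 0 ≤ v σ) ∧ ∑ σ, v σ = 1 ∧
      (∀ σ i, (Finset.univ.filter fun j => F σ j = i).card = a i) ∧
      ∀ i j, w i j = ∑ σ, if F σ j = i then v σ else 0 := by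
  have hcard : ∑ i, a i = p := by
    have : (∑ i, (a i : ℝ)) = p := by
      simp_rw [← hrow]
      rw [Finset.sum_comm]
      simp [hcol]
    exact_mod_cast this
  let e : Fin p ≃ Σ i, Fin (a i) :=
    (finCongr hcard.symm).trans finSigmaFinEquiv.symm
  have hfib : ∀ i, (Finset.univ.filter fun r => (e r).1 = i).card = a i := fun i => by
    rw [Finset.card_filter, e.sum_comp (fun s => if s.1 = i then 1 else 0), Fintype.sum_sigma,
      Fintype.sum_eq_single i fun k hk => by simp [hk]]
    simp
  have ha : ∀ i j, a i = 0 → w i j = 0 := fun i j hi => by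
    have := hrow i
    rw [hi, Nat.cast_zero, Finset.sum_eq_zero_iff_of_nonneg fun j _ => h0 i j] at this
    exact this j (Finset.mem_univ j)
  let M : Matrix (Fin p) (Fin p) ℝ := fun r j => w (e r).1 j / a (e r).1
  have hfibsum : ∀ i j, ∑ r with (e r).1 = i, M r j = w i j := fun i j => by
    rw [Finset.sum_congr rfl (g := fun _ => w i j / a i) fun r hr => by
      simp [M, (Finset.mem_filter.1 hr).2], Finset.sum_const, hfib, nsmul_eq_mul]
    rcases eq_or_ne (a i) 0 with hi | hi
    · simp [hi, ha i j hi]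
    · rw [mul_div_cancel₀]
      exact_mod_cast hi
  have hM : M ∈ doublyStochastic ℝ (Fin p) := by
    refine mem_doublyStochastic_iff_sum.2 ⟨fun r j => div_nonneg (h0 _ _) (Nat.cast_nonneg _),
      fun r => ?_, fun j => ?_⟩
    · simp only [M]
      rw [← Finset.sum_div, hrow, div_self]
      have : 0 < a (e r).1 := Fin.pos (e r).2
      exact_mod_cast this.ne'
    · rw [← Finset.sum_fiberwise _ fun r => (e r).1, ← hcol j]
      exact Finset.sum_congr rfl fun i _ => hfibsum i j
  obtain ⟨v, hv0, hv1, hv⟩ := exists_eq_sum_perm_of_mem_doublyStochastic hM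
  refine ⟨v, fun σ j => (e (σ.symm j)).1, hv0, hv1, fun σ i => ?_, fun i j => ?_⟩
  · rw [← hfib i, Finset.card_filter, Finset.card_filter,
      σ.symm.sum_comp fun r => if (e r).1 = i then 1 else 0]
  · rw [← hfibsum, ← hv]
    simp only [Matrix.sum_apply, Matrix.smul_apply, smul_eq_mul]
    rw [Finset.sum_comm]
    refine Finset.sum_congr rfl fun σ _ => ?_
    rw [← Finset.mul_sum, ← mul_boole]
    congr 1
    simp only [PEquiv.toMatrix_apply, Equiv.toPEquiv_apply, Option.mem_some_iff,
      ← Equiv.eq_symm_apply]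
    simp [Finset.sum_ite_eq', Finset.mem_filter]

theorem minkSum_convex {ι E : Type*} [AddCommGroup E] [Module ℝ E] (J : Finset ι)
    {A : ι → Set E} (hA : ∀ i, Convex ℝ (A i)) : Convex ℝ (minkSum J A) := by
  rintro _ ⟨x, hx, rfl⟩ _ ⟨y, hy, rfl⟩ s t hs ht hst
  refine ⟨fun i => s • x i + t • y i, fun i hi => hA i (hx i hi) (hy i hi) hs ht hst, ?_⟩
  rw [Finset.sum_add_distrib, Finset.smul_sum, Finset.smul_sum]

/-- The integer point of the Cayley base corresponding to a composition of `p`. -/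
def compositionPt (n : ℕ) (a : Fin n → ℕ) : Fin (n - 1) → ℤ :=
  fun l => a ⟨l, l.2.trans_le (Nat.sub_le n 1)⟩

theorem sum_mul_cayleyPt {n : ℕ} (w : Fin n → ℝ) (l : Fin (n - 1)) :
    ∑ i, w i * cayleyPt n i l = w ⟨l, l.2.trans_le (Nat.sub_le n 1)⟩ := by
  rw [Finset.sum_eq_single ⟨l, l.2.trans_le (Nat.sub_le n 1)⟩]
  · simp [cayleyPt]
  · intro i _ hi
    simp [cayleyPt, Fin.ext_iff.not.1 hi]
  · simp

theorem compositionPt_injOn (n p : ℕ) :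
    Set.InjOn (compositionPt n) (Finset.Nat.antidiagonalTuple n p : Set (Fin n → ℕ)) := by
  intro a ha b hb hab
  rw [Finset.mem_coe, Finset.Nat.mem_antidiagonalTuple] at ha hb
  cases n with
  | zero => exact Subsingleton.elim _ _
  | succ n =>
    have hcast : ∀ l : Fin n, a l.castSucc = b l.castSucc := fun l => by
      exact Nat.cast_injective (R := ℤ) (congrFun hab l)
    rw [Fin.sum_univ_castSucc] at ha hb
    simp only [hcast] at ha
    exact funext fun i => Fin.lastCases (by omega) hcast i

/-- Nonnegative reals with sum `p`, all but the last of which are integers. -/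
theorem exists_composition {n p : ℕ} {α : Fin n → ℝ} (h0 : ∀ i, 0 ≤ α i) (hα : ∑ i, α i = p)
    {u : Fin (n - 1) → ℤ} (hu : ∀ l, (u l : ℝ) = α ⟨l, l.2.trans_le (Nat.sub_le n 1)⟩) :
    ∃ a ∈ Finset.Nat.antidiagonalTuple n p, compositionPt n a = u ∧ ∀ i, α i = a i := by
  have hint : ∀ i, ∃ k : ℤ, α i = k := by
    cases n with
    | zero => exact fun i => i.elim0
    | succ n =>
      have hcast : ∀ l : Fin n, α l.castSucc = u l := fun l => (hu l).symm
      rw [Fin.sum_univ_castSucc] at hα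
      refine fun i => Fin.lastCases ⟨p - ∑ l : Fin n, u l, ?_⟩ (fun l => ⟨u l, hcast l⟩) i
      push_cast
      simp only [hcast] at hα
      linarith
  choose k hk using hint
  have hk0 : ∀ i, 0 ≤ k i := fun i => by
    have := h0 i
    rw [hk] at this
    exact_mod_cast this
  have hnat : ∀ i, α i = ((k i).toNat : ℝ) := fun i => by
    rw [hk]
    exact_mod_cast (Int.toNat_of_nonneg (hk0 i)).symm
  refine ⟨fun i => (k i).toNat, Finset.Nat.mem_antidiagonalTuple.2 ?_, funext fun l => ?_, hnat⟩
  · simp only [hnat] at hα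
    exact_mod_cast hα
  · have := hu l
    rw [hnat] at this
    exact_mod_cast this.symm

theorem mem_minkSum_cayley_iff {m n p : ℕ} {Δ : Fin n → Fin p → Set (Fin m → ℝ)}
    (hΔ : ∀ i j, Convex ℝ (Δ i j)) (u : Fin (n - 1) → ℤ) (x : Fin m → ℝ) :
    ((fun l => (u l : ℝ)), x) ∈ minkSum Finset.univ (fun j => cayley n m (fun i => Δ i j)) ↔
      ∃ a ∈ Finset.Nat.antidiagonalTuple n p, compositionPt n a = u ∧
        x ∈ joinOfPartitions Δ a := by
  constructor
  · rintro ⟨z, hz, hsum⟩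
    choose w y hw0 hw1 hy hzw using fun j =>
      exists_weights_of_mem_cayley (fun i => hΔ i j) (hz j (Finset.mem_univ j))
    simp only [hzw] at hsum
    obtain ⟨hsum1, hsum2⟩ := Prod.ext_iff.1 hsum
    simp only [Prod.fst_sum, Prod.snd_sum, Prod.smul_fst, Prod.smul_snd] at hsum1 hsum2
    obtain ⟨a, ha, hau, haw⟩ := exists_composition (p := p) (u := u)
      (α := fun i => ∑ j, w j i) (fun i => Finset.sum_nonneg fun j _ => hw0 j i)
      (by rw [Finset.sum_comm]; simp [hw1]) (fun l => by
        have := congrFun hsum1 l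
        simpa only [Finset.sum_apply, Pi.smul_apply, smul_eq_mul, sum_mul_cayleyPt] using this)
    refine ⟨a, ha, hau, ?_⟩
    obtain ⟨v, F, hv0, hv1, hF, hwF⟩ := exists_convexCombination_of_integral_margins
      (w := fun i j => w j i) (fun i j => hw0 j i) hw1 a haw
    have hx : x = ∑ σ with 0 < v σ, v σ • ∑ j, y j (F σ j) := by
      rw [Finset.sum_filter_of_ne fun σ _ hσ =>
        (hv0 σ).lt_of_ne fun h => hσ (by rw [← h, zero_smul]), hsum2]
      simp only [Finset.smul_sum]
      rw [Finset.sum_comm (s := Finset.univ (α := Equiv.Perm (Fin p)))]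
      refine Finset.sum_congr (M := Fin m → ℝ) rfl fun j _ => ?_
      simp only [hwF, Finset.sum_smul]
      rw [Finset.sum_comm]
      simp [ite_smul]
    rw [hx]
    have hconv : Convex ℝ (joinOfPartitions Δ a) := convex_convexHull ℝ _
    refine hconv.sum_mem (fun σ _ => hv0 σ) ?_ fun σ hσ => ?_
    · rw [Finset.sum_filter_of_ne fun σ _ hσ => (hv0 σ).lt_of_ne hσ.symm, hv1]
    · refine subset_convexHull ℝ _ (mem_biUnion (hF σ) ⟨fun j => y j (F σ j), fun j _ => ?_, rfl⟩)
      refine hy j _ ((Finset.mem_filter.1 hσ).2.trans_le ?_)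
      rw [hwF (F σ j) j]
      refine (Finset.single_le_sum (f := fun τ => if F τ j = F σ j then v τ else 0)
        (fun τ _ => ?_) (Finset.mem_univ σ)).trans' (by simp)
      split_ifs
      exacts [hv0 τ, le_rfl]
  · rintro ⟨a, ha, rfl, hx⟩
    have hS := minkSum_convex (E := (Fin (n - 1) → ℝ) × (Fin m → ℝ)) Finset.univ
      (A := fun j => cayley n m fun i => Δ i j) fun j => convex_convexHull ℝ _
    refine convexHull_min (t := {x | ((fun l => (compositionPt n a l : ℝ)), x) ∈
      minkSum Finset.univ fun j => cayley n m fun i => Δ i j}) ?_ ?_ hx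
    · refine iUnion₂_subset fun f hf => ?_
      rintro _ ⟨y, hy, rfl⟩
      refine ⟨fun j => (cayleyPt n (f j), y j), fun j hj => subset_convexHull ℝ _
        (mem_iUnion.2 ⟨f j, rfl, hy j hj⟩), Prod.ext (funext fun l => ?_) ?_⟩
      · simp only [Prod.fst_sum, Finset.sum_apply, compositionPt, ← hf ⟨l, _⟩,
          Finset.card_filter, cayleyPt, Fin.ext_iff]
        push_cast
        rfl
      · simp only [Prod.snd_sum]
    · intro x hx y hy s t hs ht hst
      have := hS hx hy hs ht hst
      simp only [Prod.smul_mk, Prod.mk_add_mk, ← add_smul, hst, one_smul] at this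
      exact this

theorem finite_setOf_intCast_mem {m : ℕ} {A : Set (Fin m → ℝ)} (hA : IsBounded A) :
    {z : Fin m → ℤ | (fun l => (z l : ℝ)) ∈ A}.Finite := by
  obtain ⟨r, hr⟩ := hA.exists_norm_le
  refine (finite_Icc (fun _ => -⌈r⌉ : Fin m → ℤ) fun _ => ⌈r⌉).subset fun z hz => ?_
  have key : ∀ l, |z l| ≤ ⌈r⌉ := fun l => by
    have := ((norm_le_pi_norm _ l).trans (hr _ hz)).trans (Int.le_ceil r)
    rw [Real.norm_eq_abs] at this
    exact_mod_cast this
  exact ⟨fun l => (abs_le.1 (key l)).1, fun l => (abs_le.1 (key l)).2⟩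

theorem ncard_minkSum_cayley_diff {m n p : ℕ} {Δ Φ : Fin n → Fin p → Set (Fin m → ℝ)}
    (hΔ : ∀ i j, Convex ℝ (Δ i j)) (hΦ : ∀ i j, Convex ℝ (Φ i j))
    (hbdd : ∀ a, IsBounded (joinOfPartitions Δ a \ joinOfPartitions Φ a)) :
    Set.ncard {z : (Fin (n - 1) → ℤ) × (Fin m → ℤ) |
        ((fun l => (z.1 l : ℝ)), (fun l => (z.2 l : ℝ))) ∈
          minkSum Finset.univ (fun j => cayley n m (fun i => Δ i j)) \
          minkSum Finset.univ (fun j => cayley n m (fun i => Φ i j))} =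
      ∑ a ∈ Finset.Nat.antidiagonalTuple n p,
        Set.ncard {z : Fin m → ℤ | (fun l => (z l : ℝ)) ∈
          joinOfPartitions Δ a \ joinOfPartitions Φ a} := by
  set T : (Fin n → ℕ) → Set (Fin m → ℤ) := fun a => {z | (fun l => (z l : ℝ)) ∈
    joinOfPartitions Δ a \ joinOfPartitions Φ a} with hT
  have hunion : {z : (Fin (n - 1) → ℤ) × (Fin m → ℤ) |
      ((fun l => (z.1 l : ℝ)), (fun l => (z.2 l : ℝ))) ∈
        minkSum Finset.univ (fun j => cayley n m (fun i => Δ i j)) \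
        minkSum Finset.univ (fun j => cayley n m (fun i => Φ i j))} =
      ⋃ a ∈ (Finset.Nat.antidiagonalTuple n p : Set (Fin n → ℕ)),
        Prod.mk (compositionPt n a) '' T a := by
    ext ⟨u, x⟩
    simp only [mem_ofPred_eq, mem_sdiff, mem_minkSum_cayley_iff hΔ, mem_minkSum_cayley_iff hΦ,
      mem_iUnion₂]
    constructor
    · rintro ⟨⟨a, ha, hau, hx⟩, h⟩
      exact ⟨a, ha, x, ⟨hx, fun hx' => h ⟨a, ha, hau, hx'⟩⟩, by rw [hau]⟩
    · rintro ⟨a, ha, y, ⟨hy, hy'⟩, h⟩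
      obtain ⟨rfl, rfl⟩ := Prod.mk_inj.1 h
      refine ⟨⟨a, ha, rfl, hy⟩, ?_⟩
      rintro ⟨b, hb, hba, hb'⟩
      rw [compositionPt_injOn n p hb ha hba] at hb'
      exact hy' hb'
  rw [hunion, (Finset.finite_toSet _).ncard_biUnion, finsum_mem_coe_finset]
  · exact Finset.sum_congr rfl fun a _ => ncard_image_of_injective _ (Prod.mk_right_injective _)
  · exact fun a _ => (finite_setOf_intCast_mem (hbdd a)).image _
  · intro a ha b hb hab
    refine disjoint_left.2 ?_
    rintro _ ⟨x, -, rfl⟩ ⟨y, -, h⟩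
    exact hab (compositionPt_injOn n p ha hb (Prod.mk_inj.1 h).1.symm)

theorem lattice_count_of_sum_of_cayley_pairs {m n p : ℕ}
    (C : Set (Fin m → ℝ)) (hC : IsConvexCone C)
    (Δ Φ : Fin n → Fin p → Set (Fin m → ℝ))
    (hΔpoly : ∀ i j, IsPolyhedron (Δ i j)) (hΦpoly : ∀ i j, IsPolyhedron (Φ i j))
    (hΔpar : ∀ i j, Parallel (Δ i j) C) (hΦpar : ∀ i j, Parallel (Φ i j) C)
    (hbdd : ∀ i j, IsBounded (Δ i j \ Φ i j) ∧ IsBounded (Φ i j \ Δ i j)) :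
    IpairProd (minkSum Finset.univ (fun j => cayley n m (fun i => Δ i j)))
        (minkSum Finset.univ (fun j => cayley n m (fun i => Φ i j))) =
      ∑ a ∈ Finset.Nat.antidiagonalTuple n p,
        Ipair (joinOfPartitions Δ a) (joinOfPartitions Φ a) := by
  have hΔ := fun i j => (hΔpoly i j).convex
  have hΦ := fun i j => (hΦpoly i j).convex
  unfold IpairProd Ipair
  rw [Finset.sum_sub_distrib, ← Nat.cast_sum, ← Nat.cast_sum,
    ncard_minkSum_cayley_diff hΔ hΦ fun a => isBounded_joinOfPartitions_diff hC hΔpoly hΦpoly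
      hΔpar hΦpar (fun i j => (hbdd i j).1) a,
    ncard_minkSum_cayley_diff hΦ hΔ fun a => isBounded_joinOfPartitions_diff hC hΦpoly hΔpoly
      hΦpar hΔpar (fun i j => (hbdd i j).2) a]
end
end

section
/- Let S ⊂ ℝ^q be the standard q-dimensional simplex (the convex hull of the origin and the standard basis vectors), and let l_1, …, l_p be linear functions on ℝ^q. Then for each integer lattice point a ∈ pS, the maximum of l_1(x_1) + … + l_p(x_p) over all p-tuples (x_1, …, x_p) of points of S with x_1 + … + x_p = a equals the maximum of l_1(c_1) + … + l_p(c_p) over all p-tuples (c_1, …, c_p) of vertices of S with c_1 + … + c_p = a. (Equivalently: if Γ_i ⊂ ℝ^q ⊕ ℝ is the graph of l_i restricted to S and l is the maximal piecewise-linear function on pS whose graph is contained in Γ_1 + … + Γ_p, then l(a) equals the maximum of Σ_i l_i(c_i) over p-tuples of vertices c_i of S with Σ_i c_i = a.) -/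
/-!
STATEMENT 10 (maxima over decompositions in the standard simplex).
Let `S ⊂ ℝ^q` be the standard `q`-dimensional simplex and `l_1, …, l_p` linear functions
on `ℝ^q`.  For each integer lattice point `a ∈ pS`, the maximum of
`l_1(x_1) + … + l_p(x_p)` over tuples of points `x_i ∈ S` with `Σ x_i = a` exists,
the maximum over tuples of vertices `c_i` of `S` with `Σ c_i = a` exists, and the two
maxima are equal. -/

open Set Pointwise

noncomputable section

/-- The vertex set of the standard simplex: the origin and the standard basis vectors. -/
def stdSimplexVertices (q : ℕ) : Set (Fin q → ℝ) :=
  insert 0 {x | ∃ i : Fin q, x = Pi.single i 1}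

/-- The standard `q`-dimensional simplex in `ℝ^q`. -/
def stdSimplexSet (q : ℕ) : Set (Fin q → ℝ) :=
  convexHull ℝ (stdSimplexVertices q)

/-- A linear functional on the doubly stochastic matrices is dominated by its value at some
permutation matrix. -/
lemma exists_perm_sum_mul_le {n : Type*} [Fintype n] [DecidableEq n] {D : Matrix n n ℝ}
    (hD : D ∈ doublyStochastic ℝ n) (C : n → n → ℝ) :
    ∃ σ : Equiv.Perm n, ∑ i, ∑ j, D i j * C i j ≤ ∑ i, C i (σ i) := by
  let f : Matrix n n ℝ →ₗ[ℝ] ℝ :=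
    { toFun := fun M => ∑ i, ∑ j, M i j * C i j
      map_add' := fun M N => by simp [add_mul, Finset.sum_add_distrib]
      map_smul' := fun r M => by simp [Finset.mul_sum, mul_assoc] }
  rw [← SetLike.mem_coe, doublyStochastic_eq_convexHull_permMatrix] at hD
  obtain ⟨_, ⟨σ, rfl⟩, hσ⟩ :=
    (f.convexOn convex_univ).exists_ge_of_mem_convexHull (subset_univ _) hD
  refine ⟨σ, hσ.trans_eq ?_⟩
  simp [f, Equiv.toPEquiv_apply]

/-- Rounding in a transportation polytope: a nonnegative matrix with unit row sums and natural
number column sums is dominated, for a linear objective, by a `0`-`1` matrix with the same row and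
column sums, given here as the function selecting the nonzero entry of each row. -/
lemma exists_integral_assignment_ge {ι J : Type*} [Fintype ι] [Fintype J]
    {w : ι → J → ℝ} (hw : ∀ i j, 0 ≤ w i j) (hrow : ∀ i, ∑ j, w i j = 1) {b : J → ℕ}
    (hcol : ∀ j, ∑ i, w i j = b j) (C : ι → J → ℝ) :
    ∃ f : ι → J, ∑ i, ∑ j, w i j * C i j ≤ ∑ i, C i (f i) ∧
      ∀ g : J → ℝ, ∑ i, g (f i) = ∑ j, b j * g j := by
  classical
  have hcard : Fintype.card ι = Fintype.card (Σ j, Fin (b j)) := by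
    have h : (∑ j, (b j : ℝ)) = Fintype.card ι := by
      simp_rw [← hcol]
      rw [Finset.sum_comm]
      simp [hrow]
    simp only [Fintype.card_sigma, Fintype.card_fin]
    exact_mod_cast h.symm
  let e : ι ≃ Σ j, Fin (b j) := Fintype.equivOfCardEq hcard
  have hsum (g : J → ℝ) : ∑ i, g (e i).1 = ∑ j, b j * g j := by
    rw [e.sum_comp (fun s => g s.1), Fintype.sum_sigma]
    simp
  have hzero {j : J} (hj : (b j : ℝ) = 0) (i : ι) : w i j = 0 :=
    (Finset.sum_eq_zero_iff_of_nonneg fun i _ => hw i j).1 ((hcol j).trans hj) i (Finset.mem_univ i)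
  have hcancel (i : ι) (j : J) : b j * (w i j / b j) = w i j := by
    by_cases hj : (b j : ℝ) = 0
    · simp [hj, hzero hj]
    · field_simp
  let D : Matrix ι ι ℝ := fun i k => w i (e k).1 / b (e k).1
  have hD : D ∈ doublyStochastic ℝ ι := by
    refine mem_doublyStochastic_iff_sum.2 ⟨fun i k => div_nonneg (hw _ _) (Nat.cast_nonneg _),
      fun i => ?_, fun k => ?_⟩
    · rw [hsum fun j => w i j / b j]
      simp_rw [hcancel, hrow]
    · simp only [D]
      rw [← Finset.sum_div, hcol, div_self]
      exact_mod_cast (Fin.pos (e k).2).ne'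
  obtain ⟨σ, hσ⟩ := exists_perm_sum_mul_le hD fun i k => C i (e k).1
  refine ⟨fun i => (e (σ i)).1, le_of_eq_of_le ?_ hσ, fun g => ?_⟩
  · refine Finset.sum_congr rfl fun i _ => ?_
    rw [hsum fun j => w i j / b j * C i j]
    simp_rw [← mul_assoc, hcancel]
  · rw [Equiv.sum_comp σ fun k => g (e k).1, hsum]

/-- The vertices of the standard simplex, with `none` labelling the origin. -/
def stdSimplexVertex (q : ℕ) (j : Option (Fin q)) : Fin q → ℝ :=
  j.elim 0 fun t => Pi.single t 1

lemma stdSimplexVertex_mem {q : ℕ} (j : Option (Fin q)) :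
    stdSimplexVertex q j ∈ stdSimplexVertices q := by
  cases j with
  | none => exact mem_insert _ _
  | some t => exact mem_insert_of_mem _ ⟨t, rfl⟩

lemma finite_stdSimplexVertices (q : ℕ) : (stdSimplexVertices q).Finite := by
  refine Finite.insert 0 ((finite_range fun i : Fin q => (Pi.single i 1 : Fin q → ℝ)).subset ?_)
  rintro _ ⟨i, rfl⟩
  exact mem_range_self i

lemma nonneg_and_sum_le_one_of_mem_stdSimplexSet {q : ℕ} {x : Fin q → ℝ}
    (hx : x ∈ stdSimplexSet q) : (∀ t, 0 ≤ x t) ∧ ∑ t, x t ≤ 1 := by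
  have hconv : Convex ℝ {x : Fin q → ℝ | (∀ t, 0 ≤ x t) ∧ ∑ t, x t ≤ 1} := by
    rintro x ⟨hx, hx'⟩ y ⟨hy, hy'⟩ r s hr hs hrs
    refine ⟨fun t => add_nonneg (mul_nonneg hr (hx t)) (mul_nonneg hs (hy t)), ?_⟩
    simp only [Pi.add_apply, Pi.smul_apply, smul_eq_mul, Finset.sum_add_distrib, ← Finset.mul_sum]
    nlinarith
  refine convexHull_min ?_ hconv hx
  rintro _ (rfl | ⟨i, rfl⟩)
  · simp
  · exact ⟨fun t => (Pi.single_nonneg.2 zero_le_one : (0 : Fin q → ℝ) ≤ Pi.single i 1) t, by simp⟩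

/-- Every decomposition of a lattice point into points of the simplex is dominated by a
decomposition into vertices. -/
lemma exists_vertex_decomposition_ge {q p : ℕ} (l : Fin p → ((Fin q → ℝ) →ₗ[ℝ] ℝ))
    (a : Fin q → ℤ) {x : Fin p → (Fin q → ℝ)} (hx : ∀ i, x i ∈ stdSimplexSet q)
    (hsum : ∑ i, x i = fun t => (a t : ℝ)) :
    ∃ c : Fin p → (Fin q → ℝ), (∀ i, c i ∈ stdSimplexVertices q) ∧
      ∑ i, c i = (fun t => (a t : ℝ)) ∧ ∑ i, l i (x i) ≤ ∑ i, l i (c i) := by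
  have hx' i := nonneg_and_sum_le_one_of_mem_stdSimplexSet (hx i)
  have hcoord (t : Fin q) : ∑ i, x i t = a t := by
    rw [← Finset.sum_apply, hsum]
  let w : Fin p → Option (Fin q) → ℝ := fun i j => j.elim (1 - ∑ t, x i t) (x i)
  have hw (i) (j) : 0 ≤ w i j := by
    cases j with
    | none => exact sub_nonneg.2 (hx' i).2
    | some t => exact (hx' i).1 t
  have hint (j) : ∃ n : ℤ, ∑ i, w i j = n := by
    cases j with
    | none =>
      refine ⟨p - ∑ t, a t, ?_⟩
      simp only [w, Option.elim_none, Finset.sum_sub_distrib]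
      rw [Finset.sum_comm]
      simp [hcoord]
    | some t => exact ⟨a t, hcoord t⟩
  have hnat (j) : ∃ n : ℕ, ∑ i, w i j = n := by
    obtain ⟨n, hn⟩ := hint j
    have h0 : (0 : ℝ) ≤ n := hn ▸ Finset.sum_nonneg fun i _ => hw i j
    lift n to ℕ using by exact_mod_cast h0
    exact ⟨n, by simpa using hn⟩
  choose b hb using hnat
  obtain ⟨f, hf, hfg⟩ := exists_integral_assignment_ge hw
    (fun i => by simp [w, Fintype.sum_option]) hb fun i j => l i (stdSimplexVertex q j)
  refine ⟨fun i => stdSimplexVertex q (f i), fun i => stdSimplexVertex_mem _, ?_,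
    le_of_eq_of_le ?_ hf⟩
  · funext t
    rw [Finset.sum_apply, hfg fun j => stdSimplexVertex q j t, ← hcoord t]
    simp [Fintype.sum_option, stdSimplexVertex, Pi.single_apply, ← hb, w]
  · refine Finset.sum_congr rfl fun i _ => ?_
    conv_lhs => rw [(l i).pi_apply_eq_sum_univ]
    have hsingle (t : Fin q) : (fun j => if t = j then (1 : ℝ) else 0) = Pi.single t 1 := by
      ext j
      simp [Pi.single_apply, eq_comm]
    simp [Fintype.sum_option, stdSimplexVertex, w, hsingle]

theorem max_over_simplex_decompositions_attained_at_vertices {q p : ℕ}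
    (l : Fin p → ((Fin q → ℝ) →ₗ[ℝ] ℝ)) (a : Fin q → ℤ)
    (ha : (fun t => (a t : ℝ)) ∈ (p : ℝ) • stdSimplexSet q) :
    ∃ M : ℝ,
      IsGreatest {s : ℝ | ∃ x : Fin p → (Fin q → ℝ), (∀ i, x i ∈ stdSimplexSet q) ∧
        (∑ i, x i) = (fun t => (a t : ℝ)) ∧ s = ∑ i, l i (x i)} M ∧
      IsGreatest {s : ℝ | ∃ c : Fin p → (Fin q → ℝ), (∀ i, c i ∈ stdSimplexVertices q) ∧
        (∑ i, c i) = (fun t => (a t : ℝ)) ∧ s = ∑ i, l i (c i)} M := by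
  obtain ⟨s, hs, hsa⟩ := ha
  set V : Set ℝ := {s : ℝ | ∃ c : Fin p → (Fin q → ℝ), (∀ i, c i ∈ stdSimplexVertices q) ∧
    (∑ i, c i) = (fun t => (a t : ℝ)) ∧ s = ∑ i, l i (c i)}
  have hfin : V.Finite := by
    refine ((Finite.pi' fun _ : Fin p => finite_stdSimplexVertices q).image
      fun c => ∑ i, l i (c i)).subset ?_
    rintro _ ⟨c, hc, -, rfl⟩
    exact ⟨c, hc, rfl⟩
  have hne : V.Nonempty := by
    obtain ⟨c, hc, hca, -⟩ := exists_vertex_decomposition_ge l a (x := fun _ => s)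
      (fun _ => hs) (by rw [← hsa]; ext t; simp)
    exact ⟨_, c, hc, hca, rfl⟩
  obtain ⟨M, hM, hmax⟩ := exists_max_image V id hfin hne
  refine ⟨M, ⟨?_, ?_⟩, hM, fun s hs => hmax s hs⟩
  · obtain ⟨c, hc, hca, rfl⟩ := hM
    exact ⟨c, fun i => subset_convexHull ℝ _ (hc i), hca, rfl⟩
  · rintro _ ⟨x, hx, hxa, rfl⟩
    obtain ⟨c, hc, hca, hle⟩ := exists_vertex_decomposition_ge l a hx hxa
    exact hle.trans (hmax _ ⟨c, hc, hca, rfl⟩)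
end
end
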